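/- arXiv:1502.02337 — 4 statements merged into one kernel-verified Lean document; each statement's English description precedes it below -/
import Mathlib

section
/- Let d ≥ 1, 0 < α₁, and ω_* > 0. (i) For every q ∈ (dα₁/2, ∞] and all constants c, Λ > 0, there exist a sequence (ω_j)_{j∈ℕ} in (0, ω_*) and a sequence (v_j)_{j∈ℕ} in ℝ^d such that A_q ≤ c and v_* ≥ Λ. (ii) If moreover α₁ < 2 and p ∈ (dα₁/(2−α₁), ∞], then the sequences (ω_j) and (v_j) can be chosen so that in addition B_p ≤ c. -/
open scoped ENNReal

/-- The Japanese bracket `⟨v⟩ = (1+|v|²)^{1/2}`. -/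
noncomputable def jbracket {d : ℕ} (v : EuclideanSpace ℝ (Fin d)) : ℝ :=
  Real.sqrt (1 + ‖v‖ ^ 2)

/-- `A_p := (Σ_j ω_j^{min(1,p)(1/α₁ − d/(2p))})^{max(1,1/p)}` for `0 < p ≤ ∞`, with the
conventions `d/(2p) = 0` and `min(1,p) = max(1,1/p) = 1` for `p = ∞`; `ℝ≥0∞`-valued. -/
noncomputable def ApE (d : ℕ) (α₁ : ℝ) (ω : ℕ → ℝ) (p : ℝ≥0∞) : ℝ≥0∞ :=
  if p = ⊤ then ∑' j, ENNReal.ofReal (ω j ^ (1 / α₁))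
  else (∑' j, ENNReal.ofReal (ω j ^ (min 1 p.toReal * (1 / α₁ - d / (2 * p.toReal))))) ^
    max 1 (1 / p.toReal)

/-- `B_p := (Σ_j ⟨v_j⟩^{min(1,p)} ω_j^{min(1,p)(1/α₁ − d/(2p))})^{max(1,1/p)}`. -/
noncomputable def BpE (d : ℕ) (α₁ : ℝ) (ω : ℕ → ℝ)
    (v : ℕ → EuclideanSpace ℝ (Fin d)) (p : ℝ≥0∞) : ℝ≥0∞ :=
  if p = ⊤ then ∑' j, ENNReal.ofReal (jbracket (v j) * ω j ^ (1 / α₁))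
  else (∑' j, ENNReal.ofReal (jbracket (v j) ^ min 1 p.toReal *
      ω j ^ (min 1 p.toReal * (1 / α₁ - d / (2 * p.toReal))))) ^ max 1 (1 / p.toReal)

/-- `v_* := ½ · inf_{j<k} min(1, ω_j^{1/2}, ω_k^{1/2}) |v_j − v_k|`. -/
noncomputable def vstar {d : ℕ} (ω : ℕ → ℝ) (v : ℕ → EuclideanSpace ℝ (Fin d)) : ℝ :=
  (1 / 2) * sInf {r : ℝ | ∃ j k : ℕ, j < k ∧
    r = min 1 (min (Real.sqrt (ω j)) (Real.sqrt (ω k))) * ‖v j - v k‖}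

open Filter Topology in
/-- A rescaled geometric series, raised to a positive power, tends to zero with the scale. -/
lemma eventually_tsum_dyadic_rpow_le {K t E c : ℝ} (hK : 0 ≤ K) (ht : 0 < t) (hE : 0 < E)
    (hc : 0 < c) :
    ∀ᶠ ε : ℝ in 𝓝[>] 0,
      (∑' j : ℕ, ENNReal.ofReal (K * (ε * (1 / 2) ^ j) ^ t)) ^ E ≤ ENNReal.ofReal c := by
  set r : ℝ := (1 / 2) ^ t with hr
  have hr0 : 0 ≤ r := by positivity
  have hr1 : r < 1 := Real.rpow_lt_one (by norm_num) (by norm_num) ht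
  set M : ℝ≥0∞ := (1 - ENNReal.ofReal r)⁻¹ with hM
  have hMtop : M ≠ ⊤ := by
    rw [hM, ENNReal.inv_ne_top]
    exact (tsub_pos_of_lt (by simpa using hr1)).ne'
  have hsum : ∀ ε : ℝ, 0 < ε →
      (∑' j : ℕ, ENNReal.ofReal (K * (ε * (1 / 2) ^ j) ^ t)) = ENNReal.ofReal (K * ε ^ t) * M := by
    intro ε hε
    rw [hM, ← ENNReal.tsum_geometric, ← ENNReal.tsum_mul_left]
    refine tsum_congr fun j => ?_
    rw [← ENNReal.ofReal_pow hr0, ← ENNReal.ofReal_mul (by positivity),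
      Real.mul_rpow hε.le (by positivity), ← mul_assoc, hr, Real.rpow_pow_comm (by norm_num)]
  have hε : Tendsto (fun ε : ℝ => K * ε ^ t) (𝓝[>] 0) (𝓝 0) := by
    have : Tendsto (fun ε : ℝ => K * ε ^ t) (𝓝 0) (𝓝 (K * 0 ^ t)) :=
      ((Real.continuousAt_rpow_const 0 t (Or.inr ht.le)).tendsto).const_mul K
    rw [Real.zero_rpow ht.ne', mul_zero] at this
    exact this.mono_left nhdsWithin_le_nhds
  have hlim : Tendsto (fun ε : ℝ => (ENNReal.ofReal (K * ε ^ t) * M) ^ E) (𝓝[>] 0) (𝓝 0) := by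
    have h1 := ENNReal.Tendsto.mul_const (ENNReal.tendsto_ofReal hε) (Or.inr hMtop)
    have h2 := (ENNReal.continuous_rpow_const (y := E)).continuousAt.tendsto.comp h1
    simpa [Function.comp_def, ENNReal.zero_rpow_of_pos hE] using h2
  filter_upwards [hlim.eventually_le_const (ENNReal.ofReal_pos.2 hc), self_mem_nhdsWithin]
    with ε h hpos
  rwa [hsum ε hpos]

/-- The squared dyadic frequencies `(ε 2⁻ʲ)²`. -/
noncomputable def dyadicFreq (ε : ℝ) (j : ℕ) : ℝ := (ε * (1 / 2) ^ j) ^ 2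

/-- The collinear velocities `(L / (ε 2⁻ʲ)) e`. -/
noncomputable def dyadicVel {d : ℕ} (L : ℝ) (e : EuclideanSpace ℝ (Fin d)) (ε : ℝ) (j : ℕ) :
    EuclideanSpace ℝ (Fin d) := (L / (ε * (1 / 2) ^ j)) • e

lemma dyadicFreq_mem_Ioo {ε b : ℝ} (hε : 0 < ε) (hε1 : ε ≤ 1) (hb : ε < b) (j : ℕ) :
    dyadicFreq ε j ∈ Set.Ioo 0 b := by
  have hj : ((1 : ℝ) / 2) ^ j ≤ 1 := pow_le_one₀ (by norm_num) (by norm_num)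
  have hs : ε * (1 / 2) ^ j ≤ ε := mul_le_of_le_one_right hε.le hj
  have hs0 : 0 < ε * (1 / 2) ^ j := by positivity
  refine ⟨by unfold dyadicFreq; positivity, ?_⟩
  unfold dyadicFreq
  nlinarith

lemma dyadicFreq_rpow {ε : ℝ} (hε : 0 < ε) (j : ℕ) (a : ℝ) :
    dyadicFreq ε j ^ a = (ε * (1 / 2) ^ j) ^ (2 * a) := by
  rw [dyadicFreq, Real.rpow_mul (by positivity), Real.rpow_two]

lemma jbracket_nonneg {d : ℕ} (v : EuclideanSpace ℝ (Fin d)) : 0 ≤ jbracket v :=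
  Real.sqrt_nonneg _

lemma jbracket_dyadicVel_le {d : ℕ} {L ε : ℝ} {e : EuclideanSpace ℝ (Fin d)} (he : ‖e‖ = 1)
    (hL : 0 < L) (hε : 0 < ε) (hε1 : ε ≤ 1) (j : ℕ) :
    jbracket (dyadicVel L e ε j) ≤ (1 + L) * (ε * (1 / 2) ^ j)⁻¹ := by
  have hj : ((1 : ℝ) / 2) ^ j ≤ 1 := pow_le_one₀ (by norm_num) (by norm_num)
  have hs1 : ε * (1 / 2) ^ j ≤ 1 := mul_le_one₀ hε1 (by positivity) hj
  have hs0 : 0 < ε * (1 / 2) ^ j := by positivity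
  unfold jbracket dyadicVel
  rw [norm_smul, he, mul_one, Real.norm_of_nonneg (by positivity), div_eq_mul_inv]
  generalize ε * (1 / 2) ^ j = s at hs1 hs0
  have hx : 1 ≤ s⁻¹ := (one_le_inv₀ hs0).2 hs1
  refine Real.sqrt_le_iff.2 ⟨by positivity, ?_⟩
  nlinarith [mul_pos hL hs0, mul_nonneg hL.le (sq_nonneg s⁻¹)]

lemma jbracket_dyadicVel_rpow_mul_le {d : ℕ} {L ε m : ℝ} {e : EuclideanSpace ℝ (Fin d)}
    (he : ‖e‖ = 1) (hL : 0 < L) (hm : 0 ≤ m) (hε : 0 < ε) (hε1 : ε ≤ 1) (j : ℕ) (a : ℝ) :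
    jbracket (dyadicVel L e ε j) ^ m * dyadicFreq ε j ^ a ≤
      (1 + L) ^ m * (ε * (1 / 2) ^ j) ^ (2 * a - m) := by
  have hs0 : 0 < ε * (1 / 2) ^ j := by positivity
  calc jbracket (dyadicVel L e ε j) ^ m * dyadicFreq ε j ^ a
      ≤ ((1 + L) * (ε * (1 / 2) ^ j)⁻¹) ^ m * (ε * (1 / 2) ^ j) ^ (2 * a) := by
        rw [dyadicFreq_rpow hε]
        gcongr
        · exact jbracket_nonneg _
        · exact jbracket_dyadicVel_le he hL hε hε1 j
    _ = _ := by
        rw [Real.mul_rpow (by positivity) (by positivity), Real.inv_rpow hs0.le,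
          Real.rpow_sub hs0]
        ring

lemma le_vstar_dyadic {d : ℕ} {Λ ε : ℝ} {e : EuclideanSpace ℝ (Fin d)} (he : ‖e‖ = 1)
    (hΛ : 0 < Λ) (hε : 0 < ε) (hε1 : ε ≤ 1) :
    Λ ≤ vstar (dyadicFreq ε) (dyadicVel (4 * Λ) e ε) := by
  suffices 2 * Λ ≤ sInf {r : ℝ | ∃ j k : ℕ, j < k ∧
      r = min 1 (min (Real.sqrt (dyadicFreq ε j)) (Real.sqrt (dyadicFreq ε k))) *
        ‖dyadicVel (4 * Λ) e ε j - dyadicVel (4 * Λ) e ε k‖} by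
    unfold vstar
    linarith
  refine le_csInf ⟨_, 0, 1, zero_lt_one, rfl⟩ ?_
  rintro _ ⟨j, k, hjk, rfl⟩
  have hk : ((1 : ℝ) / 2) ^ k ≤ 1 := pow_le_one₀ (by norm_num) (by norm_num)
  have hsk1 : ε * (1 / 2) ^ k ≤ 1 := mul_le_one₀ hε1 (by positivity) hk
  have hpow : ((1 : ℝ) / 2) ^ k ≤ (1 / 2) ^ j / 2 := by
    have := pow_le_pow_of_le_one (a := (1 : ℝ) / 2) (by norm_num) (by norm_num)
      (Nat.succ_le_of_lt hjk)
    rw [Nat.succ_eq_add_one, pow_succ] at this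
    linarith
  have hle : ε * (1 / 2) ^ k ≤ ε * (1 / 2) ^ j / 2 := by
    rw [mul_div_assoc]
    gcongr
  have hj0 : 0 < ε * (1 / 2) ^ j := by positivity
  have hk0 : 0 < ε * (1 / 2) ^ k := by positivity
  unfold dyadicFreq dyadicVel
  rw [Real.sqrt_sq hj0.le, Real.sqrt_sq hk0.le, ← sub_smul, norm_smul, he, mul_one]
  generalize ε * (1 / 2) ^ k = y at *
  generalize ε * (1 / 2) ^ j = x at *
  rw [min_eq_right (by linarith : y ≤ x), min_eq_right hsk1]
  have hyx : y / x ≤ 1 / 2 := by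
    rw [div_le_iff₀ hj0]
    linarith
  calc 2 * Λ ≤ 4 * Λ * (1 - y / x) := by nlinarith
    _ = y * -(4 * Λ / x - 4 * Λ / y) := by field_simp; ring
    _ ≤ y * ‖4 * Λ / x - 4 * Λ / y‖ := by
        gcongr
        exact neg_le_abs _

open Filter Topology in
lemma eventually_ApE_dyadicFreq_le {d : ℕ} {α₁ c : ℝ} {q : ℝ≥0∞} (hα₁ : 0 < α₁)
    (hq : ENNReal.ofReal (d * α₁ / 2) < q) (hc : 0 < c) :
    ∀ᶠ ε : ℝ in 𝓝[>] 0, ApE d α₁ (dyadicFreq ε) q ≤ ENNReal.ofReal c := by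
  by_cases hqt : q = ⊤
  · have h := eventually_tsum_dyadic_rpow_le zero_le_one
      (by positivity : 0 < 2 * (1 / α₁)) zero_lt_one hc
    filter_upwards [h, self_mem_nhdsWithin] with ε hε hpos
    rw [ENNReal.rpow_one] at hε
    rw [ApE, if_pos hqt]
    simpa only [dyadicFreq_rpow hpos, one_mul] using hε
  · have hq' : d * α₁ / 2 < q.toReal := (ENNReal.ofReal_lt_iff_lt_toReal (by positivity) hqt).1 hq
    have hq0 : 0 < q.toReal := lt_of_le_of_lt (by positivity) hq'
    have hexp : 0 < 1 / α₁ - d / (2 * q.toReal) := by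
      rw [sub_pos, div_lt_div_iff₀ (by positivity) hα₁]
      linarith
    have h := eventually_tsum_dyadic_rpow_le zero_le_one
      (by positivity : 0 < 2 * (min 1 q.toReal * (1 / α₁ - d / (2 * q.toReal))))
      (by positivity : 0 < max 1 (1 / q.toReal)) hc
    filter_upwards [h, self_mem_nhdsWithin] with ε hε hpos
    rw [ApE, if_neg hqt]
    simpa only [dyadicFreq_rpow hpos, one_mul] using hε

open Filter Topology in
lemma eventually_BpE_dyadic_le {d : ℕ} {α₁ c L : ℝ} {p : ℝ≥0∞}
    {e : EuclideanSpace ℝ (Fin d)} (he : ‖e‖ = 1) (hL : 0 < L) (hα₁ : 0 < α₁) (hα₂ : α₁ < 2)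
    (hp : ENNReal.ofReal (d * α₁ / (2 - α₁)) < p) (hc : 0 < c) :
    ∀ᶠ ε : ℝ in 𝓝[>] 0, BpE d α₁ (dyadicFreq ε) (dyadicVel L e ε) p ≤ ENNReal.ofReal c := by
  have hsmall : ∀ᶠ ε : ℝ in 𝓝[>] 0, ε < 1 :=
    nhdsWithin_le_nhds (eventually_lt_nhds zero_lt_one)
  have hα : 0 < 2 - α₁ := sub_pos.2 hα₂
  by_cases hpt : p = ⊤
  · have hexp : 0 < 2 * (1 / α₁) - 1 := by
      rw [mul_one_div, sub_pos, one_lt_div hα₁]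
      exact hα₂
    have h := eventually_tsum_dyadic_rpow_le (by positivity : 0 ≤ (1 + L) ^ (1 : ℝ)) hexp
      zero_lt_one hc
    filter_upwards [h, self_mem_nhdsWithin, hsmall] with ε hε hpos hε1
    rw [ENNReal.rpow_one] at hε
    rw [BpE, if_pos hpt]
    refine le_trans (ENNReal.tsum_le_tsum fun j => ENNReal.ofReal_le_ofReal ?_) hε
    simpa only [Real.rpow_one] using
      jbracket_dyadicVel_rpow_mul_le he hL zero_le_one hpos hε1.le j (1 / α₁)
  · have hp' : d * α₁ / (2 - α₁) < p.toReal :=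
      (ENNReal.ofReal_lt_iff_lt_toReal (by positivity) hpt).1 hp
    have hp0 : 0 < p.toReal := lt_of_le_of_lt (by positivity) hp'
    have hm : 0 < min 1 p.toReal := by positivity
    have hhalf : 1 / 2 < 1 / α₁ - d / (2 * p.toReal) := by
      rw [div_lt_iff₀ hα] at hp'
      rw [div_sub_div _ _ hα₁.ne' (by positivity), div_lt_div_iff₀ (by norm_num) (by positivity)]
      nlinarith
    have hexp : 0 < 2 * (min 1 p.toReal * (1 / α₁ - d / (2 * p.toReal))) - min 1 p.toReal := by
      nlinarith
    have h := eventually_tsum_dyadic_rpow_le (by positivity : 0 ≤ (1 + L) ^ min 1 p.toReal) hexp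
      (by positivity : 0 < max 1 (1 / p.toReal)) hc
    filter_upwards [h, self_mem_nhdsWithin, hsmall] with ε hε hpos hε1
    rw [BpE, if_neg hpt]
    refine le_trans (ENNReal.rpow_le_rpow (ENNReal.tsum_le_tsum fun j =>
      ENNReal.ofReal_le_ofReal ?_) (by positivity)) hε
    exact jbracket_dyadicVel_rpow_mul_le he hL hm.le hpos hε1.le j _

/-- (i) For every `q ∈ (dα₁/2, ∞]` and all `c, Λ > 0` there are
sequences `(ω_j) ⊆ (0, ω_*)` and `(v_j) ⊆ ℝ^d` with `A_q ≤ c` and `v_* ≥ Λ`.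
(ii) If moreover `α₁ < 2` and `p ∈ (dα₁/(2−α₁), ∞]`, the sequences can be chosen so
that in addition `B_p ≤ c`. -/
theorem stmt_14 (d : ℕ) (hd : 1 ≤ d) (α₁ ωst : ℝ) (hα₁ : 0 < α₁) (hωst : 0 < ωst) :
    (∀ q : ℝ≥0∞, ENNReal.ofReal (d * α₁ / 2) < q →
      ∀ c Λ : ℝ, 0 < c → 0 < Λ →
        ∃ (ω : ℕ → ℝ) (v : ℕ → EuclideanSpace ℝ (Fin d)),
          (∀ j, ω j ∈ Set.Ioo 0 ωst) ∧
          ApE d α₁ ω q ≤ ENNReal.ofReal c ∧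
          Λ ≤ vstar ω v) ∧
    (α₁ < 2 →
      ∀ q p : ℝ≥0∞, ENNReal.ofReal (d * α₁ / 2) < q →
        ENNReal.ofReal (d * α₁ / (2 - α₁)) < p →
        ∀ c Λ : ℝ, 0 < c → 0 < Λ →
          ∃ (ω : ℕ → ℝ) (v : ℕ → EuclideanSpace ℝ (Fin d)),
            (∀ j, ω j ∈ Set.Ioo 0 ωst) ∧
            ApE d α₁ ω q ≤ ENNReal.ofReal c ∧
            BpE d α₁ ω v p ≤ ENNReal.ofReal c ∧
            Λ ≤ vstar ω v) := by
  obtain ⟨e, he⟩ : ∃ e : EuclideanSpace ℝ (Fin d), ‖e‖ = 1 :=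
    ⟨EuclideanSpace.single ⟨0, hd⟩ 1, by simp⟩
  have hsmall : ∀ᶠ ε : ℝ in nhdsWithin 0 (Set.Ioi 0), 0 < ε ∧ ε < 1 ∧ ε < ωst := by
    filter_upwards [self_mem_nhdsWithin, nhdsWithin_le_nhds (eventually_lt_nhds zero_lt_one),
      nhdsWithin_le_nhds (eventually_lt_nhds hωst)] with ε h0 h1 h2 using ⟨h0, h1, h2⟩
  refine ⟨fun q hq c Λ hc hΛ => ?_, fun hα₂ q p hq hp c Λ hc hΛ => ?_⟩
  · obtain ⟨ε, ⟨h0, h1, h2⟩, hA⟩ :=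
      (hsmall.and (eventually_ApE_dyadicFreq_le hα₁ hq hc)).exists
    exact ⟨dyadicFreq ε, dyadicVel (4 * Λ) e ε, dyadicFreq_mem_Ioo h0 h1.le h2, hA,
      le_vstar_dyadic he hΛ h0 h1.le⟩
  · have hB := eventually_BpE_dyadic_le he (by positivity : 0 < 4 * Λ) hα₁ hα₂ hp hc
    obtain ⟨ε, ⟨h0, h1, h2⟩, hA, hB⟩ :=
      (hsmall.and ((eventually_ApE_dyadicFreq_le hα₁ hq hc).and hB)).exists
    exact ⟨dyadicFreq ε, dyadicVel (4 * Λ) e ε, dyadicFreq_mem_Ioo h0 h1.le h2, hA, hB,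
      le_vstar_dyadic he hΛ h0 h1.le⟩
end

section
/- Let 0 < p ≤ q ≤ ∞. There exists a constant C̃ > 0, depending only on p, with C̃ ≤ (1 − e^{−1})^{−1} whenever p ≥ 1, such that the following holds: for every λ > 0 and every measurable u : [0,∞) → [0,∞], if ‖u‖_{L^q([t,∞))} ≤ e^{−λt} for all t ≥ 0, then ‖u‖_{L^p([t,∞))} ≤ C̃ · λ^{1/q − 1/p} · e^{−λt} for all t ≥ 0. (One may take C̃ = 1 if p = q, C̃ = p^{−1/p} if p < q = ∞, and C̃ = (1 − e^{−p})^{−1/p} if p < q < ∞.) -/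
open MeasureTheory
open scoped ENNReal

/-- The `L^r` norm of an `[0,∞]`-valued function on the interval `[t,∞)`, for
`0 < r ≤ ∞` (essential supremum when `r = ∞`). -/
noncomputable def lpNormIci (u : ℝ → ℝ≥0∞) (r : ℝ≥0∞) (t : ℝ) : ℝ≥0∞ :=
  if r = ⊤ then essSup u (volume.restrict (Set.Ici t))
  else (∫⁻ τ in Set.Ici t, u τ ^ r.toReal) ^ (1 / r.toReal)

/-- `lpNormIci` is the `eLpNorm` for Lebesgue measure restricted to `[t,∞)`. -/
theorem lpNormIci_eq_eLpNorm {r : ℝ≥0∞} (hr : r ≠ 0) (u : ℝ → ℝ≥0∞) (t : ℝ) :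
    lpNormIci u r t = eLpNorm u r (volume.restrict (Set.Ici t)) := by
  unfold lpNormIci
  split_ifs with h
  · simp [h, eLpNorm_exponent_top, eLpNormEssSup]
  · simp [eLpNorm_eq_lintegral_rpow_enorm_toReal hr h]

theorem iUnion_Ico_add_nat_div {lam : ℝ} (hlam : 0 < lam) (t : ℝ) :
    ⋃ k : ℕ, Set.Ico (t + k / lam) (t + (k + 1) / lam) = Set.Ici t := by
  have h := iUnion_Ico_map_succ_eq_Ici (f := fun k : ℕ => t + k / lam)
    (fun k => by simp; positivity) (by
      rintro ⟨B, hB⟩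
      obtain ⟨n, hn⟩ := exists_nat_gt ((B - t) * lam)
      have h1 : t + n / lam ≤ B := hB ⟨n, rfl⟩
      have h2 : B - t < n / lam := by rwa [lt_div_iff₀ hlam]
      linarith)
  simpa using h

/-- Hölder's inequality on an interval of length `1 / lam`. -/
theorem setLIntegral_Ico_rpow_le {p q : ℝ≥0∞} (hp : 0 < p) (hp' : p ≠ ⊤) (hpq : p ≤ q)
    {lam : ℝ} (hlam : 0 < lam) {u : ℝ → ℝ≥0∞} (hu : Measurable u) {a b B : ℝ}
    (hab : b - a = 1 / lam) (hB : 0 ≤ B) (h : lpNormIci u q a ≤ ENNReal.ofReal B) :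
    ∫⁻ τ in Set.Ico a b, u τ ^ p.toReal ≤
      ENNReal.ofReal ((lam ^ (1 / q.toReal - 1 / p.toReal) * B) ^ p.toReal) := by
  have hP : 0 < p.toReal := ENNReal.toReal_pos hp.ne' hp'
  have key : eLpNorm u p (volume.restrict (Set.Ico a b)) ≤
      ENNReal.ofReal (lam ^ (1 / q.toReal - 1 / p.toReal) * B) := by
    calc eLpNorm u p (volume.restrict (Set.Ico a b))
        ≤ eLpNorm u q (volume.restrict (Set.Ico a b)) *
          (volume.restrict (Set.Ico a b)) Set.univ ^ (1 / p.toReal - 1 / q.toReal) :=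
          eLpNorm_le_eLpNorm_mul_rpow_measure_univ hpq hu.aestronglyMeasurable
      _ ≤ ENNReal.ofReal B * ENNReal.ofReal (lam ^ (1 / q.toReal - 1 / p.toReal)) := by
          gcongr
          · refine (eLpNorm_mono_measure u
              (Measure.restrict_mono Set.Ico_subset_Ici_self le_rfl)).trans ?_
            rwa [← lpNormIci_eq_eLpNorm (hp.trans_le hpq).ne']
          · rw [Measure.restrict_apply_univ, Real.volume_Ico, hab,
              ENNReal.ofReal_rpow_of_pos (by positivity), one_div, Real.inv_rpow hlam.le,
              ← Real.rpow_neg hlam.le, neg_sub]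
      _ = _ := by rw [← ENNReal.ofReal_mul hB, mul_comm]
  rw [eLpNorm_eq_lintegral_rpow_enorm_toReal hp.ne' hp', one_div,
    ENNReal.rpow_inv_le_iff hP, ENNReal.ofReal_rpow_of_nonneg (by positivity) hP.le] at key
  simpa using key

theorem lpNormIci_le_of_exp_decay {p q : ℝ≥0∞} (hp : 0 < p) (hp' : p ≠ ⊤) (hpq : p ≤ q)
    {lam : ℝ} (hlam : 0 < lam) {u : ℝ → ℝ≥0∞} (hu : Measurable u)
    (h : ∀ t : ℝ, 0 ≤ t → lpNormIci u q t ≤ ENNReal.ofReal (Real.exp (-lam * t)))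
    {t : ℝ} (ht : 0 ≤ t) :
    lpNormIci u p t ≤ ENNReal.ofReal (((1 - Real.exp (-p.toReal))⁻¹) ^ (1 / p.toReal) *
      lam ^ (1 / q.toReal - 1 / p.toReal) * Real.exp (-lam * t)) := by
  have hP : 0 < p.toReal := ENNReal.toReal_pos hp.ne' hp'
  have hr : Real.exp (-p.toReal) < 1 := by simpa using hP
  have hr' : 0 < 1 - Real.exp (-p.toReal) := by linarith
  set A : ℝ := lam ^ (1 / q.toReal - 1 / p.toReal) * Real.exp (-lam * t) with hA
  have hA0 : 0 ≤ A := by positivity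
  have hgeom := (hasSum_geometric_of_lt_one (Real.exp_pos _).le hr).mul_left (A ^ p.toReal)
  have hint (k : ℕ) : ∫⁻ τ in Set.Ico (t + k / lam) (t + (k + 1) / lam), u τ ^ p.toReal ≤
      ENNReal.ofReal (A ^ p.toReal * Real.exp (-p.toReal) ^ k) := by
    refine (setLIntegral_Ico_rpow_le hp hp' hpq hlam hu (by ring) (Real.exp_pos _).le
      (h (t + k / lam) (by positivity))).trans_eq ?_
    have hexp : -lam * (t + k / lam) = -lam * t + -k := by field_simp; ring
    rw [hexp, Real.exp_add, ← mul_assoc, ← hA, Real.mul_rpow hA0 (Real.exp_pos _).le,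
      ← Real.exp_mul, ← Real.exp_nat_mul, neg_mul_comm]
  rw [mul_assoc, ← hA, lpNormIci, if_neg hp', one_div, ENNReal.rpow_inv_le_iff hP]
  calc ∫⁻ τ in Set.Ici t, u τ ^ p.toReal
      ≤ ∑' k : ℕ, ∫⁻ τ in Set.Ico (t + k / lam) (t + (k + 1) / lam), u τ ^ p.toReal := by
        rw [← iUnion_Ico_add_nat_div hlam t]
        exact lintegral_iUnion_le _ _
    _ ≤ ∑' k : ℕ, ENNReal.ofReal (A ^ p.toReal * Real.exp (-p.toReal) ^ k) :=
        ENNReal.tsum_le_tsum hint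
    _ = ENNReal.ofReal (A ^ p.toReal * (1 - Real.exp (-p.toReal))⁻¹) := by
        rw [← ENNReal.ofReal_tsum_of_nonneg (fun k => by positivity) hgeom.summable,
          hgeom.tsum_eq]
    _ = _ := by
        rw [ENNReal.ofReal_rpow_of_nonneg (by positivity) hP.le,
          Real.mul_rpow (by positivity) hA0, ← Real.rpow_mul (by positivity),
          inv_mul_cancel₀ hP.ne', Real.rpow_one, mul_comm]

theorem inv_one_sub_exp_neg_rpow_le {x : ℝ} (hx : 1 ≤ x) :
    ((1 - Real.exp (-x))⁻¹) ^ (1 / x) ≤ (1 - Real.exp (-1))⁻¹ := by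
  have h1 : Real.exp (-1) < 1 := by simp
  have h2 : Real.exp (-x) ≤ Real.exp (-1) := by simpa using hx
  have h3 : 0 < 1 - Real.exp (-1) := by linarith
  have h4 : 0 < 1 - Real.exp (-x) := by linarith
  calc ((1 - Real.exp (-x))⁻¹) ^ (1 / x) ≤ ((1 - Real.exp (-x))⁻¹) ^ (1 : ℝ) := by
        refine Real.rpow_le_rpow_of_exponent_le ?_ ((div_le_one (by linarith)).2 hx)
        exact (one_le_inv₀ h4).2 (by linarith [Real.exp_pos (-x)])
    _ = (1 - Real.exp (-x))⁻¹ := Real.rpow_one _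
    _ ≤ (1 - Real.exp (-1))⁻¹ := by gcongr

/-- Let `0 < p ≤ q ≤ ∞`. There is `C̃ > 0`, depending only on `p`, with
`C̃ ≤ (1 − e^{−1})^{−1}` for `p ≥ 1`, such that for every `λ > 0` and every measurable
`u : [0,∞) → [0,∞]`: if `‖u‖_{L^q([t,∞))} ≤ e^{−λt}` for all `t ≥ 0`, then
`‖u‖_{L^p([t,∞))} ≤ C̃ λ^{1/q − 1/p} e^{−λt}` for all `t ≥ 0`. -/
theorem stmt_15 (p : ℝ≥0∞) (hp : 0 < p) :
    ∃ C : ℝ, 0 < C ∧ (1 ≤ p → C ≤ (1 - Real.exp (-1))⁻¹) ∧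
      ∀ q : ℝ≥0∞, p ≤ q →
      ∀ lam : ℝ, 0 < lam →
      ∀ u : ℝ → ℝ≥0∞, Measurable u →
        (∀ t : ℝ, 0 ≤ t → lpNormIci u q t ≤ ENNReal.ofReal (Real.exp (-lam * t))) →
        ∀ t : ℝ, 0 ≤ t →
          lpNormIci u p t ≤
            ENNReal.ofReal
              (C * lam ^ (1 / q.toReal - 1 / p.toReal) * Real.exp (-lam * t)) := by
  rcases eq_or_ne p ⊤ with rfl | hp'
  · refine ⟨1, one_pos, fun _ => ?_, fun q hq lam _ u _ h t ht => ?_⟩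
    · exact (one_le_inv₀ (by simp)).2 (by linarith [Real.exp_pos (-1)])
    · obtain rfl : q = ⊤ := top_le_iff.1 hq
      simpa using h t ht
  · have hP : 0 < p.toReal := ENNReal.toReal_pos hp.ne' hp'
    have hr : 0 < 1 - Real.exp (-p.toReal) := by simpa using hP
    refine ⟨((1 - Real.exp (-p.toReal))⁻¹) ^ (1 / p.toReal), by positivity, fun h1 => ?_,
      fun q hq lam hlam u hu h t ht => lpNormIci_le_of_exp_decay hp hp' hq hlam hu h ht⟩
    exact inv_one_sub_exp_neg_rpow_le (by simpa using ENNReal.toReal_mono hp' h1)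
end

section
/- Let d ≥ 1 and set r_max := ∞ if d = 1, r_max := 4 if d = 2, and r_max := 2d/(d−2) if d ≥ 3. For every real m with 0 ≤ m ≤ 4/d, there exist q, r ∈ [2, ∞] such that: (i) 2/q + d/r = d/2; (ii) 2 ≤ r ≤ r_max; (iii) 2/((m+1)q′) + d/((m+1)r′) ≥ d/2; and (iv) 2 ≤ (m+1)r′ ≤ r_max, where q′ and r′ denote the Hölder conjugates of q and r (1/q + 1/q′ = 1, 1/r + 1/r′ = 1, with the conventions 1′ = ∞ and ∞′ = 1). -/
open scoped ENNReal

/-- `r_max := ∞` if `d = 1`, `4` if `d = 2`, and `2d/(d−2)` if `d ≥ 3`. -/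
noncomputable def rmax (d : ℕ) : ℝ≥0∞ :=
  if d = 1 then ⊤ else if d = 2 then 4 else (2 * d : ℝ≥0∞) / ((d : ℝ≥0∞) - 2)

/-- The reciprocal of `rmax d`, as a real number. -/
noncomputable def rmaxRecip (d : ℕ) : ℝ :=
  if d = 1 then 0 else if d = 2 then 1 / 4 else 1 / 2 - 1 / d

theorem rmax_eq_inv_ofReal (d : ℕ) (hd : 1 ≤ d) :
    rmax d = (ENNReal.ofReal (rmaxRecip d))⁻¹ := by
  unfold rmax rmaxRecip
  split_ifs with h1 h2
  · simp
  · rw [← ENNReal.ofReal_inv_of_pos (by norm_num)]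
    norm_num
  · have h3 : (3 : ℝ) ≤ d := by exact_mod_cast (by omega : 3 ≤ d)
    have hpos : (0 : ℝ) < 1 / 2 - 1 / d := by
      have : (1 : ℝ) / d ≤ 1 / 3 := one_div_le_one_div_of_le (by norm_num) h3
      linarith
    have e1 : (2 * d : ℝ≥0∞) = ENNReal.ofReal (2 * d) := by
      rw [ENNReal.ofReal_mul (by norm_num)]; simp
    have e2 : ((d : ℝ≥0∞) - 2) = ENNReal.ofReal (d - 2) := by
      rw [ENNReal.ofReal_sub _ (by norm_num)]; simp
    rw [e1, e2, ← ENNReal.ofReal_inv_of_pos hpos, ← ENNReal.ofReal_div_of_pos (by linarith)]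
    congr 1
    have : (d : ℝ) - 2 ≠ 0 := by linarith
    have : (d : ℝ) ≠ 0 := by linarith
    field_simp

theorem rmaxRecip_nonneg (d : ℕ) (hd : 1 ≤ d) : 0 ≤ rmaxRecip d := by
  unfold rmaxRecip
  split_ifs with h1 h2
  · rfl
  · norm_num
  · have h3 : (3 : ℝ) ≤ d := by exact_mod_cast (by omega : 3 ≤ d)
    have : (1 : ℝ) / d ≤ 1 / 3 := one_div_le_one_div_of_le (by norm_num) h3
    linarith

theorem rmaxRecip_le_half (d : ℕ) : rmaxRecip d ≤ 1 / 2 := by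
  unfold rmaxRecip
  split_ifs
  · norm_num
  · norm_num
  · have : (0 : ℝ) ≤ 1 / d := by positivity
    linarith

theorem mul_half_sub_rmaxRecip_le_one (d : ℕ) (hd : 1 ≤ d) :
    (d : ℝ) * (1 / 2 - rmaxRecip d) ≤ 1 := by
  unfold rmaxRecip
  split_ifs with h1 h2
  · subst h1; norm_num
  · subst h2; norm_num
  · have : (d : ℝ) ≠ 0 := by positivity
    field_simp
    norm_num

theorem add_two_mul_rmaxRecip_le_one (d : ℕ) (hd : 1 ≤ d) {m : ℝ} (hm : m ≤ 4 / (d : ℝ)) :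
    (m + 2) * rmaxRecip d ≤ 1 := by
  refine (mul_le_mul_of_nonneg_right (add_le_add_left hm 2) (rmaxRecip_nonneg d hd)).trans ?_
  unfold rmaxRecip
  split_ifs with h1 h2
  · norm_num
  · subst h2; norm_num
  · have hd0 : (0 : ℝ) < d := by positivity
    have : (4 / (d : ℝ) + 2) * (1 / 2 - 1 / d) = 1 - 4 / d ^ 2 := by field_simp; ring
    rw [this]
    have : (0 : ℝ) ≤ 4 / d ^ 2 := by positivity
    linarith

theorem ENNReal.ofReal_mul_inv_ofReal {a c : ℝ} (hc : 0 < c) :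
    ENNReal.ofReal c * (ENNReal.ofReal a)⁻¹ = (ENNReal.ofReal (a / c))⁻¹ := by
  rw [ENNReal.ofReal_div_of_pos hc, ENNReal.inv_div (Or.inl ENNReal.ofReal_ne_top)
    (Or.inl (ENNReal.ofReal_pos.2 hc).ne'), div_eq_mul_inv]

theorem ENNReal.two_le_inv_ofReal {a : ℝ} (ha : a ≤ 1 / 2) : 2 ≤ (ENNReal.ofReal a)⁻¹ := by
  rw [ENNReal.le_inv_iff_le_inv]
  refine (ENNReal.ofReal_le_ofReal ha).trans_eq ?_
  rw [one_div, ENNReal.ofReal_inv_of_pos two_pos, ENNReal.ofReal_ofNat]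

theorem ENNReal.one_div_inv_ofReal_add_one_div {a : ℝ} (h0 : 0 ≤ a) (h1 : a ≤ 1) :
    1 / (ENNReal.ofReal a)⁻¹ + 1 / (ENNReal.ofReal (1 - a))⁻¹ = 1 := by
  rw [one_div, one_div, inv_inv, inv_inv, ← ENNReal.ofReal_add h0 (sub_nonneg.2 h1)]
  simp

theorem ENNReal.two_div_inv_ofReal_add_natCast_div (d : ℕ) {a b : ℝ} (ha : 0 ≤ a) (hb : 0 ≤ b) :
    2 / (ENNReal.ofReal a)⁻¹ + (d : ℝ≥0∞) / (ENNReal.ofReal b)⁻¹ =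
      ENNReal.ofReal (2 * a + d * b) := by
  rw [ENNReal.ofReal_add (by positivity) (by positivity), ENNReal.ofReal_mul zero_le_two,
    ENNReal.ofReal_mul d.cast_nonneg, ENNReal.ofReal_ofNat, ENNReal.ofReal_natCast,
    div_eq_mul_inv, div_eq_mul_inv, inv_inv, inv_inv]

/-- For `d ≥ 1` and `0 ≤ m ≤ 4/d` there exist `q, r ∈ [2,∞]` with
Hölder conjugates `q', r'` such that `(q,r)` is admissible
(`2/q + d/r = d/2`, `2 ≤ r ≤ r_max`) and `((m+1)q', (m+1)r')` is sub-admissible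
(`2/((m+1)q') + d/((m+1)r') ≥ d/2`, `2 ≤ (m+1)r' ≤ r_max`). -/
theorem stmt_16 (d : ℕ) (hd : 1 ≤ d) (m : ℝ) (hm0 : 0 ≤ m) (hm : m ≤ 4 / (d : ℝ)) :
    ∃ q r q' r' : ℝ≥0∞,
      2 ≤ q ∧ 2 ≤ r ∧
      1 / q + 1 / q' = 1 ∧ 1 / r + 1 / r' = 1 ∧
      2 / q + (d : ℝ≥0∞) / r = (d : ℝ≥0∞) / 2 ∧
      r ≤ rmax d ∧
      (d : ℝ≥0∞) / 2 ≤
        2 / (ENNReal.ofReal (m + 1) * q') + (d : ℝ≥0∞) / (ENNReal.ofReal (m + 1) * r') ∧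
      2 ≤ ENNReal.ofReal (m + 1) * r' ∧
      ENNReal.ofReal (m + 1) * r' ≤ rmax d := by
  have hρ0 := rmaxRecip_nonneg d hd
  have hρ1 := rmaxRecip_le_half d
  have hρd := mul_half_sub_rmaxRecip_le_one d hd
  have hρm := add_two_mul_rmaxRecip_le_one d hd hm
  have hd0 : (0 : ℝ) < d := by positivity
  have hmd : m * d ≤ 4 := (le_div_iff₀ hd0).1 hm
  have hc : 0 < m + 1 := by linarith
  have hhalf : (d : ℝ≥0∞) / 2 = ENNReal.ofReal (d / 2) := by
    rw [ENNReal.ofReal_div_of_pos two_pos, ENNReal.ofReal_natCast, ENNReal.ofReal_ofNat]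
  rw [rmax_eq_inv_ofReal d hd, hhalf]
  set ρ := rmaxRecip d
  obtain ⟨x, hρx, hx, hxm, hxρ⟩ : ∃ x : ℝ, ρ ≤ x ∧ x ≤ 1 / 2 ∧ 1 - x ≤ (m + 1) / 2 ∧
      (m + 1) * ρ ≤ 1 - x := by
    refine ⟨1 - max (1 / 2) ((m + 1) * ρ), ?_, ?_, ?_, ?_⟩
    · rw [le_sub_comm]
      exact max_le (by linarith) (by linarith)
    · linarith [le_max_left (1 / 2) ((m + 1) * ρ)]
    · rw [sub_sub_cancel]
      exact max_le (by linarith) (by nlinarith)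
    · rw [sub_sub_cancel]
      exact le_max_right _ _
  obtain ⟨y, hy⟩ : ∃ y : ℝ, y = d / 2 * (1 / 2 - x) := ⟨_, rfl⟩
  have hy0 : 0 ≤ y := hy ▸ mul_nonneg (by positivity) (by linarith)
  have hy1 : y ≤ 1 / 2 := by nlinarith
  refine ⟨(ENNReal.ofReal y)⁻¹, (ENNReal.ofReal x)⁻¹, (ENNReal.ofReal (1 - y))⁻¹,
    (ENNReal.ofReal (1 - x))⁻¹, ENNReal.two_le_inv_ofReal hy1, ENNReal.two_le_inv_ofReal hx,
    ENNReal.one_div_inv_ofReal_add_one_div hy0 (by linarith),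
    ENNReal.one_div_inv_ofReal_add_one_div (by linarith) (by linarith), ?_,
    ENNReal.inv_le_inv.2 (ENNReal.ofReal_le_ofReal hρx), ?_, ?_, ?_⟩
  · rw [ENNReal.two_div_inv_ofReal_add_natCast_div d hy0 (by linarith), hy]
    congr 1
    ring
  · rw [ENNReal.ofReal_mul_inv_ofReal hc, ENNReal.ofReal_mul_inv_ofReal hc,
      ENNReal.two_div_inv_ofReal_add_natCast_div d (div_nonneg (by linarith) hc.le)
        (div_nonneg (by linarith) hc.le)]
    apply ENNReal.ofReal_le_ofReal
    have : 2 * ((1 - y) / (m + 1)) + d * ((1 - x) / (m + 1)) = (2 + d / 2) / (m + 1) := by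
      rw [hy]
      field_simp
      ring
    rw [this, le_div_iff₀ hc]
    linarith
  · rw [ENNReal.ofReal_mul_inv_ofReal hc]
    apply ENNReal.two_le_inv_ofReal
    rw [div_le_iff₀ hc]
    linarith
  · rw [ENNReal.ofReal_mul_inv_ofReal hc]
    apply ENNReal.inv_le_inv.2 (ENNReal.ofReal_le_ofReal _)
    rw [le_div_iff₀ hc]
    linarith
end

section
/- Let d ≥ 1, let 0 < p₁, q₁, q₂ < ∞, let p₂ > 1/2, and let ω_* > 0. For any constants c, Λ > 0 there exist a sequence (ω_j)_{j∈ℕ} in (0, ω_*) and a sequence (v_j)_{j∈ℕ} in ℝ^d such that Ã_{q₁,q₂} ≤ c, B̃_{p₁,p₂} ≤ c, and v_* ≥ Λ. -/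
open scoped ENNReal

/-- `Ã_{r₁,r₂} := (Σ_j ω_j^{r₁r₂})^{1/r₁}`, valued in `ℝ≥0∞`. -/
noncomputable def Atilde (ω : ℕ → ℝ) (r₁ r₂ : ℝ) : ℝ≥0∞ :=
  (∑' j, ENNReal.ofReal (ω j ^ (r₁ * r₂))) ^ (1 / r₁)

/-- `B̃_{r₁,r₂} := (Σ_j ⟨v_j⟩^{r₁} ω_j^{r₁r₂})^{1/r₁}`, valued in `ℝ≥0∞`. -/
noncomputable def Btilde {d : ℕ} (ω : ℕ → ℝ) (v : ℕ → EuclideanSpace ℝ (Fin d))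
    (r₁ r₂ : ℝ) : ℝ≥0∞ :=
  (∑' j, ENNReal.ofReal (jbracket (v j) ^ r₁ * ω j ^ (r₁ * r₂))) ^ (1 / r₁)

/-- A sequence dominated by `C x^(j+1)` with `x ≤ 1/2` and `2Cx ≤ c^r` has `ℓ^{1/r}`-type sum
at most `c`. -/
theorem tsum_ofReal_rpow_le_of_le_geometric {f : ℕ → ℝ} {C x r c : ℝ} (hC : 0 ≤ C) (hx : 0 ≤ x)
    (hx2 : x ≤ 1 / 2) (hr : 0 < r) (hc : 0 < c) (hxc : 2 * C * x ≤ c ^ r)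
    (hf : ∀ j, f j ≤ C * x ^ (j + 1)) :
    (∑' j, ENNReal.ofReal (f j)) ^ (1 / r) ≤ ENNReal.ofReal c := by
  have hsum : HasSum (fun j : ℕ => C * x * (1 / 2 : ℝ) ^ j) (C * x * 2) :=
    hasSum_geometric_two.mul_left _
  have hle : ∑' j, ENNReal.ofReal (f j) ≤ ENNReal.ofReal (c ^ r) := by
    calc ∑' j, ENNReal.ofReal (f j)
        ≤ ∑' j : ℕ, ENNReal.ofReal (C * x * (1 / 2 : ℝ) ^ j) := by
          refine ENNReal.tsum_le_tsum fun j => ENNReal.ofReal_le_ofReal ((hf j).trans ?_)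
          rw [pow_succ', ← mul_assoc]
          gcongr
      _ = ENNReal.ofReal (C * x * 2) := by
          rw [← ENNReal.ofReal_tsum_of_nonneg (fun j => by positivity) hsum.summable,
            hsum.tsum_eq]
      _ ≤ ENNReal.ofReal (c ^ r) := ENNReal.ofReal_le_ofReal (by linarith)
  calc (∑' j, ENNReal.ofReal (f j)) ^ (1 / r)
      ≤ ENNReal.ofReal (c ^ r) ^ (1 / r) := ENNReal.rpow_le_rpow hle (by positivity)
    _ = ENNReal.ofReal c := by
        rw [ENNReal.ofReal_rpow_of_pos (by positivity), ← Real.rpow_mul hc.le,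
          mul_one_div_cancel hr.ne', Real.rpow_one]

theorem jbracket_le_one_add_norm {d : ℕ} (v : EuclideanSpace ℝ (Fin d)) :
    jbracket v ≤ 1 + ‖v‖ :=
  Real.sqrt_le_iff.2 ⟨by positivity, by nlinarith [norm_nonneg v]⟩

/-- For `e > 0`, `t ^ e` is eventually smaller than any positive bound as `t → 0⁺`. -/
theorem eventually_rpow_lt_nhdsGT_zero {e b : ℝ} (he : 0 < e) (hb : 0 < b) :
    ∀ᶠ t : ℝ in nhdsWithin 0 (Set.Ioi 0), t ^ e < b := by
  have h : Filter.Tendsto (fun t : ℝ => t ^ e) (nhds 0) (nhds 0) := by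
    simpa [Real.zero_rpow he.ne'] using (Real.continuousAt_rpow_const 0 e (Or.inr he.le)).tendsto
  exact (h.mono_left nhdsWithin_le_nhds).eventually_lt_const hb

/-- With weights `t^{2(j+1)}` and collinear velocities of size `4Λ t^{-(j+1)}`, `t ≤ 1/2`, the
minimal weighted separation is at least `Λ`. -/
theorem le_vstar_geometric {d : ℕ} {t Λ : ℝ} (ht : 0 < t) (ht2 : t ≤ 1 / 2) (hΛ : 0 < Λ)
    {u : EuclideanSpace ℝ (Fin d)} (hu : ‖u‖ = 1) :
    Λ ≤ vstar (fun j => (t ^ (j + 1)) ^ 2) (fun j => (4 * Λ * (t ^ (j + 1))⁻¹) • u) := by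
  suffices h : 2 * Λ ≤ sInf {r : ℝ | ∃ j k : ℕ, j < k ∧
      r = min 1 (min (Real.sqrt ((t ^ (j + 1)) ^ 2)) (Real.sqrt ((t ^ (k + 1)) ^ 2))) *
        ‖(4 * Λ * (t ^ (j + 1))⁻¹) • u - (4 * Λ * (t ^ (k + 1))⁻¹) • u‖} by
    unfold vstar
    linarith
  refine le_csInf ⟨_, 0, 1, zero_lt_one, rfl⟩ ?_
  rintro r ⟨j, k, hjk, rfl⟩
  have ha : 0 < t ^ (j + 1) := by positivity
  have hb : 0 < t ^ (k + 1) := by positivity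
  have hb1 : t ^ (k + 1) ≤ 1 := pow_le_one₀ ht.le (by linarith)
  have hba : t ^ (k + 1) ≤ t ^ (j + 1) / 2 := by
    calc t ^ (k + 1) ≤ t ^ (j + 1 + 1) :=
          pow_le_pow_of_le_one ht.le (by linarith) (by omega)
      _ = t ^ (j + 1) * t := pow_succ _ _
      _ ≤ t ^ (j + 1) * (1 / 2) := by gcongr
      _ = t ^ (j + 1) / 2 := by ring
  rw [Real.sqrt_sq ha.le, Real.sqrt_sq hb.le, min_eq_right (a := t ^ (j + 1)) (by linarith),
    min_eq_right hb1, ← sub_smul, norm_smul, hu, mul_one, Real.norm_eq_abs, abs_sub_comm]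
  generalize t ^ (j + 1) = a at *
  generalize t ^ (k + 1) = b at *
  have hratio : b / a ≤ 1 / 2 := by
    rw [div_le_iff₀ ha]
    linarith
  calc 2 * Λ ≤ 4 * Λ * (1 - b / a) := by nlinarith
    _ = b * (4 * Λ * b⁻¹ - 4 * Λ * a⁻¹) := by field_simp
    _ ≤ b * |4 * Λ * b⁻¹ - 4 * Λ * a⁻¹| := by
        gcongr
        exact le_abs_self _

/-- Let `d ≥ 1`, `0 < p₁, q₁, q₂ < ∞`, `p₂ > 1/2` and `ω_* > 0`. For any
`c, Λ > 0` there exist sequences `(ω_j) ⊆ (0, ω_*)` and `(v_j) ⊆ ℝ^d` such that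
`Ã_{q₁,q₂} ≤ c`, `B̃_{p₁,p₂} ≤ c` and `v_* ≥ Λ`. -/
theorem stmt_18 (d : ℕ) (hd : 1 ≤ d) (p₁ q₁ p₂ q₂ ωst : ℝ)
    (hp₁ : 0 < p₁) (hq₁ : 0 < q₁) (hq₂ : 0 < q₂) (hp₂ : 1 / 2 < p₂) (hωst : 0 < ωst)
    (c Λ : ℝ) (hc : 0 < c) (hΛ : 0 < Λ) :
    ∃ (ω : ℕ → ℝ) (v : ℕ → EuclideanSpace ℝ (Fin d)),
      (∀ j, ω j ∈ Set.Ioo 0 ωst) ∧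
      Atilde ω q₁ q₂ ≤ ENNReal.ofReal c ∧
      Btilde ω v p₁ p₂ ≤ ENNReal.ofReal c ∧
      Λ ≤ vstar ω v := by
  have hα : 0 < 2 * (q₁ * q₂) := by positivity
  have hβ : 0 < p₁ * (2 * p₂ - 1) := mul_pos hp₁ (by linarith)
  have hC : 0 < (1 + 4 * Λ) ^ p₁ := by positivity
  have hA : 0 < min (1 / 2) (c ^ q₁ / 2) := by positivity
  have hB : 0 < min (1 / 2) (c ^ p₁ / (2 * (1 + 4 * Λ) ^ p₁)) := by positivity
  have hM : 0 < min (1 / 2) ωst := by positivity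
  obtain ⟨t, ht, htA, htB, htM⟩ := (eventually_mem_nhdsWithin.and
    ((eventually_rpow_lt_nhdsGT_zero hα hA).and ((eventually_rpow_lt_nhdsGT_zero hβ hB).and
      (eventually_rpow_lt_nhdsGT_zero one_pos hM)))).exists
  replace ht : 0 < t := ht
  rw [Real.rpow_one] at htM
  obtain ⟨htA2, htAc⟩ := lt_min_iff.1 htA
  obtain ⟨htB2, htBc⟩ := lt_min_iff.1 htB
  obtain ⟨ht2, htω⟩ := lt_min_iff.1 htM
  rw [lt_div_iff₀ (by positivity)] at htAc htBc
  have hu : ‖(EuclideanSpace.single (⟨0, hd⟩ : Fin d) (1 : ℝ))‖ = 1 := by simp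
  have hpow (j : ℕ) (e : ℝ) : ((t ^ (j + 1)) ^ 2) ^ e = (t ^ (j + 1)) ^ (2 * e) := by
    rw [Real.rpow_mul (by positivity), Real.rpow_two]
  have hcomm (j : ℕ) (e : ℝ) : (t ^ (j + 1)) ^ e = (t ^ e) ^ (j + 1) :=
    (Real.rpow_pow_comm ht.le e (j + 1)).symm
  refine ⟨fun j => (t ^ (j + 1)) ^ 2, fun j => (4 * Λ * (t ^ (j + 1))⁻¹) •
    EuclideanSpace.single (⟨0, hd⟩ : Fin d) (1 : ℝ), fun j => ⟨by positivity, ?_⟩, ?_, ?_,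
    le_vstar_geometric ht ht2.le hΛ hu⟩
  · refine lt_of_le_of_lt ?_ htω
    simp only [← pow_mul]
    exact pow_le_of_le_one ht.le (by linarith) (by omega)
  · refine tsum_ofReal_rpow_le_of_le_geometric (C := 1) (x := t ^ (2 * (q₁ * q₂))) zero_le_one
      (by positivity) htA2.le hq₁ hc (by linarith) fun j => ?_
    rw [hpow, hcomm, one_mul]
  · refine tsum_ofReal_rpow_le_of_le_geometric (x := t ^ (p₁ * (2 * p₂ - 1))) hC.le
      (by positivity) htB2.le hp₁ hc (by linarith) fun j => ?_
    rw [hpow, ← hcomm]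
    have ha : 0 < t ^ (j + 1) := by positivity
    have ha1 : t ^ (j + 1) ≤ 1 := pow_le_one₀ ht.le (by linarith)
    have hbr : jbracket ((4 * Λ * (t ^ (j + 1))⁻¹) •
        EuclideanSpace.single (⟨0, hd⟩ : Fin d) (1 : ℝ)) ≤ (1 + 4 * Λ) * (t ^ (j + 1))⁻¹ := by
      refine (jbracket_le_one_add_norm _).trans ?_
      rw [norm_smul, hu, Real.norm_of_nonneg (by positivity)]
      linarith [(one_le_inv₀ ha).2 ha1]
    calc _ ≤ ((1 + 4 * Λ) * (t ^ (j + 1))⁻¹) ^ p₁ * (t ^ (j + 1)) ^ (2 * (p₁ * p₂)) := by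
          gcongr
          exact Real.sqrt_nonneg _
      _ = (1 + 4 * Λ) ^ p₁ * (t ^ (j + 1)) ^ (p₁ * (2 * p₂ - 1)) := by
          rw [Real.mul_rpow (by positivity) (by positivity), mul_assoc, ← Real.rpow_neg_one,
            ← Real.rpow_mul ha.le, ← Real.rpow_add ha]
          ring_nf
end
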